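/- arXiv:2511.23453 — 4 statements merged into one kernel-verified Lean document; each statement's English description precedes it below -/
import Mathlib

section
/- Let H be a real Banach space, let P : ℝ → (H →L[ℝ] H), let f, u ∈ H and λ > 0. Assume: (i) P 0 f = f; (ii) for every t ≥ 0 the map s ↦ P s f is differentiable at t (within [0,∞)) with derivative P t u; (iii) ‖P s u‖ ≤ ‖u‖ for all s ≥ 0; (iv) ‖u‖ = √(2λ)·‖f‖. Then for all t ≥ 0, ‖P t f‖ ≥ (1 − √(2λ)·t)·‖f‖. Moreover, if f ≠ 0 and T ≥ 0 satisfies ‖P T f‖ ≤ e⁻¹·‖f‖, then T ≥ (1 − e⁻¹)/√(2λ). -/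
/-- Abstract lower bound on the relaxation time of a second-order lift:
if `P_0 f = f`, `d/dt P_t f = P_t u`, `‖P_s u‖ ≤ ‖u‖` and `‖u‖ = √(2λ)‖f‖`,
then `‖P_t f‖ ≥ (1 − √(2λ) t)‖f‖`, and any `T ≥ 0` with `‖P_T f‖ ≤ e⁻¹‖f‖`
(for `f ≠ 0`) satisfies `T ≥ (1 − e⁻¹)/√(2λ)`. -/
theorem stmt1 {H : Type*} [NormedAddCommGroup H] [NormedSpace ℝ H] [CompleteSpace H]
    (P : ℝ → (H →L[ℝ] H)) (f u : H) (lam : ℝ) (hlam : 0 < lam)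
    (h0 : P 0 f = f)
    (hderiv : ∀ t ≥ (0 : ℝ), HasDerivWithinAt (fun s => P s f) (P t u) (Set.Ici 0) t)
    (hcontr : ∀ s ≥ (0 : ℝ), ‖P s u‖ ≤ ‖u‖)
    (hu : ‖u‖ = Real.sqrt (2 * lam) * ‖f‖) :
    (∀ t ≥ (0 : ℝ), (1 - Real.sqrt (2 * lam) * t) * ‖f‖ ≤ ‖P t f‖) ∧
    (f ≠ 0 → ∀ T ≥ (0 : ℝ), ‖P T f‖ ≤ (Real.exp 1)⁻¹ * ‖f‖ →
      (1 - (Real.exp 1)⁻¹) / Real.sqrt (2 * lam) ≤ T) := by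
  have lower : ∀ t ≥ (0 : ℝ), (1 - Real.sqrt (2 * lam) * t) * ‖f‖ ≤ ‖P t f‖ := by
    intro t ht
    have hmv : ‖P t f - P 0 f‖ ≤ ‖u‖ * ‖t - 0‖ :=
      (convex_Ici (0 : ℝ)).norm_image_sub_le_of_norm_hasDerivWithin_le
        (f := fun s => P s f) hderiv hcontr Set.self_mem_Ici ht
    rw [h0, hu, sub_zero, Real.norm_of_nonneg ht] at hmv
    have htri := norm_sub_norm_le f (P t f)
    rw [norm_sub_rev] at htri
    linarith
  refine ⟨lower, fun hf T hT hdecay => ?_⟩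
  have hsqrt : 0 < Real.sqrt (2 * lam) := by positivity
  have hle := le_of_mul_le_mul_right ((lower T hT).trans hdecay) (norm_pos_iff.mpr hf)
  rw [div_le_iff₀ hsqrt]
  linarith
end

section
/- Let n ≥ 2 be a natural number and fix i ∈ ℤ/nℤ. Define u : ℤ/nℤ → ℝ by u(i+k) = (1 − 1/n)·(−1/2 + k/(n−1)) for k = 0, 1, …, n−1 (k the representative in {0,…,n−1} of the index shift). Then: (a) Σ_j u(j) = 0; (b) Δ_n u = e_i − e_{i−1}, i.e. u(j+1) − 2u(j) + u(j−1) equals 1 if j = i, equals −1 if j = i−1, and equals 0 otherwise; (c) u(i−1) − u(i) = 1 − 1/n, so that (e_i − e_{i−1})ᵀ(−Δ_n)^{-1}(e_i − e_{i−1}) = 1 − 1/n; (d) if u' : ℤ/nℤ → ℝ is the analogous vector defined with i+1 in place of i, then u'(j) − u(j) = 𝟙_{j=i} − 1/n for all j, i.e. u' − u = e_i − (1/n)𝟏. -/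
theorem ZMod.cast_val_sub_one {n : ℕ} (hn : 2 ≤ n) (a : ZMod n) :
    ((a - 1).val : ℝ) = a.val - 1 + if a = 0 then (n : ℝ) else 0 := by
  obtain ⟨m, rfl⟩ : ∃ m, n = m + 1 := ⟨n - 1, by omega⟩
  have : Fact (1 < m + 1) := ⟨hn⟩
  split_ifs with h
  · subst h
    rw [zero_sub, ZMod.val_neg_one, ZMod.val_zero]
    push_cast
    ring
  · have hpos : 1 ≤ a.val := Nat.one_le_iff_ne_zero.mpr ((ZMod.val_ne_zero a).mpr h)
    have hone : (1 : ZMod (m + 1)).val = 1 := ZMod.val_one (m + 1)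
    rw [ZMod.val_sub (by rwa [hone]), hone, Nat.cast_sub hpos]
    simp

theorem ZMod.sum_cast_val (n : ℕ) [NeZero n] :
    ∑ a : ZMod n, (a.val : ℝ) = n * (n - 1) / 2 := by
  obtain ⟨m, rfl⟩ := Nat.exists_eq_succ_of_ne_zero (NeZero.ne n)
  have h : ∑ a : ZMod (m + 1), (a.val : ℝ) = ∑ k ∈ Finset.range (m + 1), (k : ℝ) :=
    Fin.sum_univ_eq_sum_range (fun k => (k : ℝ)) (m + 1)
  have h2 := congrArg (Nat.cast (R := ℝ)) (Finset.sum_range_id_mul_two (m + 1))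
  push_cast [Nat.add_sub_cancel] at h2
  rw [h]
  push_cast
  linarith

/-- Explicit inverse of the discrete Laplacian: for fixed `i ∈ ℤ/nℤ`, the vector
`u(i+k) = (1 − 1/n)(−1/2 + k/(n−1))`, `k = 0,…,n−1`, satisfies
(a) `Σ_j u_j = 0`; (b) `Δ_n u = e_i − e_{i−1}`;
(c) `u_{i−1} − u_i = 1 − 1/n` (so `(e_i − e_{i−1})ᵀ(−Δ_n)⁻¹(e_i − e_{i−1}) = 1 − 1/n`);
(d) the analogous vector `u'` for `i+1` satisfies `u' − u = e_i − (1/n)𝟏`. -/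
theorem stmt9 (n : ℕ) [NeZero n] (hn : 2 ≤ n) (i : ZMod n)
    (u u' : ZMod n → ℝ)
    (hu : ∀ j : ZMod n, u j = (1 - 1 / (n : ℝ)) * (-(1 / 2) + ((j - i).val : ℝ) / ((n : ℝ) - 1)))
    (hu' : ∀ j : ZMod n,
      u' j = (1 - 1 / (n : ℝ)) * (-(1 / 2) + ((j - (i + 1)).val : ℝ) / ((n : ℝ) - 1))) :
    (∑ j : ZMod n, u j = 0) ∧
    (∀ j : ZMod n, u (j + 1) - 2 * u j + u (j - 1) =
      (if j = i then (1 : ℝ) else 0) - (if j = i - 1 then (1 : ℝ) else 0)) ∧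
    (u (i - 1) - u i = 1 - 1 / (n : ℝ)) ∧
    (∀ j : ZMod n, u' j - u j = (if j = i then (1 : ℝ) else 0) - 1 / (n : ℝ)) := by
  have hn' : (2 : ℝ) ≤ n := by exact_mod_cast hn
  have hn0 : (n : ℝ) ≠ 0 := by linarith
  have hn1 : (n : ℝ) - 1 ≠ 0 := by linarith
  have scale (x : ℝ) : (1 - 1 / (n : ℝ)) * (-(1 / 2) + x / ((n : ℝ) - 1)) =
      x / n - (n - 1) / (2 * n) := by
    field_simp
    ring
  simp only [scale] at hu hu'
  have pred (j : ZMod n) : u (j - 1) = u j - 1 / n + if j = i then (1 : ℝ) else 0 := by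
    rw [hu, hu, sub_right_comm, ZMod.cast_val_sub_one hn]
    simp only [sub_eq_zero]
    split_ifs <;> field_simp <;> ring
  refine ⟨?_, fun j => ?_, ?_, fun j => ?_⟩
  · simp only [hu, Finset.sum_sub_distrib, ← Finset.sum_div]
    have h : ∑ j : ZMod n, ((j - i).val : ℝ) = n * (n - 1) / 2 :=
      ((Equiv.subRight i).sum_comp fun a : ZMod n => (a.val : ℝ)).trans (ZMod.sum_cast_val n)
    simp only [h, Finset.sum_const, Finset.card_univ, ZMod.card, nsmul_eq_mul]
    field_simp
    ring
  · have h := pred (j + 1)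
    rw [add_sub_cancel_right] at h
    rw [pred j]
    simp only [eq_sub_iff_add_eq (a := j)]
    linarith
  · rw [pred i, if_pos rfl]
    ring
  · have h : u' j = u (j - 1) := by rw [hu, hu', sub_sub, add_comm 1 i]
    rw [h, pred j]
    ring
end

section
/- Let n ≥ 2. Let μ be the centered Gaussian measure on EuclideanSpace ℝ (ℤ/nℤ) with covariance C (so μ is supported on the mean-zero hyperplane S). Let v : ℤ/nℤ → ℝ with Σ_i v_i = 0, and let f : EuclideanSpace ℝ (ℤ/nℤ) → ℝ be continuously differentiable with f and its derivative bounded. Then −∫ ∂_v f(ℓ) μ(dℓ) = ∫ (Σ_i v_i·(ℓ_{i+1} − 2ℓ_i + ℓ_{i−1}))·f(ℓ) μ(dℓ), i.e. −∫ ∂_v f dμ = ∫ vᵀΔ_nℓ · f(ℓ) μ(dℓ). -/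
open MeasureTheory

open ProbabilityTheory in
/-- Stein's identity for the standard Gaussian on the line. -/
lemma integral_mul_gaussianReal_eq_integral_deriv {g g' : ℝ → ℝ}
    (hg : ∀ x, HasDerivAt g (g' x) x) (hg' : Continuous g')
    {M M' : ℝ} (hM : ∀ x, |g x| ≤ M) (hM' : ∀ x, |g' x| ≤ M') :
    ∫ x, x * g x ∂(gaussianReal 0 1) = ∫ x, g' x ∂(gaussianReal 0 1) := by
  have hgc : Continuous g := continuous_iff_continuousAt.2 fun x => (hg x).continuousAt
  have hpdf (x : ℝ) : HasDerivAt (fun x => -gaussianPDFReal 0 1 x) (x * gaussianPDFReal 0 1 x) x := by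
    simp only [gaussianPDFReal_def]
    have h : HasDerivAt (fun x : ℝ => -(x - 0) ^ 2 / (2 * ((1 : NNReal) : ℝ))) (-x) x := by
      have := ((((hasDerivAt_id x).sub_const 0).pow 2).neg).div_const (2 * ((1 : NNReal) : ℝ))
      refine this.congr_deriv ?_
      simp [neg_div]
    refine ((h.exp.const_mul _).neg).congr_deriv ?_
    ring
  have hint := integrable_gaussianPDFReal 0 1
  have hid : Integrable (fun x => x * gaussianPDFReal 0 1 x) := by
    have h := (integrable_mul_exp_neg_mul_sq (b := 1 / 2) (by norm_num)).const_mul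
      (√(2 * Real.pi * ((1 : NNReal) : ℝ)))⁻¹
    refine h.congr (Filter.Eventually.of_forall fun x => ?_)
    simp only [gaussianPDFReal_def, NNReal.coe_one]
    rw [show -(x - 0) ^ 2 / (2 * 1) = -(1 / 2) * x ^ 2 by ring]
    ring
  have key := integral_mul_deriv_eq_deriv_mul_of_integrable
    (u := g) (u' := g') (v := fun x => -gaussianPDFReal 0 1 x)
    (v' := fun x => x * gaussianPDFReal 0 1 x) (fun x _ => hg x) (fun x _ => hpdf x)
    (hid.bdd_mul hgc.aestronglyMeasurable (Filter.Eventually.of_forall hM))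
    (hint.neg.bdd_mul hg'.aestronglyMeasurable (Filter.Eventually.of_forall hM'))
    (hint.neg.bdd_mul hgc.aestronglyMeasurable (Filter.Eventually.of_forall hM))
  rw [integral_gaussianReal_eq_integral_smul one_ne_zero,
    integral_gaussianReal_eq_integral_smul one_ne_zero]
  simp only [mul_neg, integral_neg, neg_neg] at key
  simp only [smul_eq_mul]
  calc _ = ∫ x, g x * (x * gaussianPDFReal 0 1 x) := by congr with x; ring
    _ = ∫ x, g' x * gaussianPDFReal 0 1 x := key
    _ = _ := by congr with x; ring

section Gaussian

open ProbabilityTheory RealInnerProductSpace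

variable {E : Type*} [NormedAddCommGroup E] [InnerProductSpace ℝ E] [FiniteDimensional ℝ E]
  [MeasurableSpace E] [BorelSpace E]

/-- A Gaussian measure is invariant under resampling its component in a direction `w` of unit
variance. -/
lemma map_resample_prod_gaussianReal {C : E →L[ℝ] E} (hC : ∀ x y, ⟪C x, y⟫ = ⟪x, C y⟫)
    {μ : Measure E} [IsProbabilityMeasure μ]
    (hμ : ∀ t, charFun μ t = Complex.exp (-(⟪t, C t⟫ : ℝ) / 2))
    {w : E} (hw : ⟪w, C w⟫ = 1) :
    (μ.prod (gaussianReal 0 1)).map (fun p => p.2 • C w + (p.1 - ⟪w, p.1⟫ • C w)) = μ := by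
  have hm : Measurable fun p : E × ℝ => p.2 • C w + (p.1 - ⟪w, p.1⟫ • C w) := by fun_prop
  have : IsProbabilityMeasure
      ((μ.prod (gaussianReal 0 1)).map (fun p => p.2 • C w + (p.1 - ⟪w, p.1⟫ • C w))) :=
    Measure.isProbabilityMeasure_map hm.aemeasurable
  refine Measure.ext_of_charFun (funext fun t => ?_)
  rw [charFun_apply, integral_map hm.aemeasurable (by fun_prop)]
  have hsplit (p : E × ℝ) :
      Complex.exp ((⟪p.2 • C w + (p.1 - ⟪w, p.1⟫ • C w), t⟫ : ℝ) * Complex.I) =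
        Complex.exp ((⟪p.1, t - ⟪C w, t⟫ • w⟫ : ℝ) * Complex.I) *
          Complex.exp ((⟪C w, t⟫ : ℝ) * p.2 * Complex.I) := by
    rw [← Complex.exp_add, ← add_mul, ← Complex.ofReal_mul, ← Complex.ofReal_add]
    congr 3
    simp only [inner_add_left, inner_sub_left, inner_sub_right, real_inner_smul_left,
      real_inner_smul_right, real_inner_comm w p.1]
    ring
  simp_rw [hsplit]
  rw [integral_prod_mul (fun x : E => Complex.exp ((⟪x, t - ⟪C w, t⟫ • w⟫ : ℝ) * Complex.I))
    (fun x : ℝ => Complex.exp ((⟪C w, t⟫ : ℝ) * x * Complex.I)), ← charFun_apply,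
    ← charFun_apply_real, charFun_gaussianReal, hμ, hμ, ← Complex.exp_add]
  have hq : ⟪t - ⟪C w, t⟫ • w, C (t - ⟪C w, t⟫ • w)⟫ = ⟪t, C t⟫ - ⟪C w, t⟫ ^ 2 := by
    simp only [map_sub, map_smul, inner_sub_left, inner_sub_right, real_inner_smul_left,
      real_inner_smul_right, hw, ← hC w t, real_inner_comm (C w) t]
    ring
  rw [hq]
  congr 1
  push_cast
  ring

/-- Gaussian integration by parts in a direction of unit variance. -/
lemma integral_inner_mul_eq_integral_fderiv_of_inner_eq_one {C : E →L[ℝ] E}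
    (hC : ∀ x y, ⟪C x, y⟫ = ⟪x, C y⟫) {μ : Measure E} [IsProbabilityMeasure μ]
    (hμ : ∀ t, charFun μ t = Complex.exp (-(⟪t, C t⟫ : ℝ) / 2))
    {w : E} (hw : ⟪w, C w⟫ = 1) {f : E → ℝ} (hf : ContDiff ℝ 1 f)
    {M M' : ℝ} (hM : ∀ x, |f x| ≤ M) (hM' : ∀ x, ‖fderiv ℝ f x‖ ≤ M') :
    ∫ x, ⟪w, x⟫ * f x ∂μ = ∫ x, fderiv ℝ f x (C w) ∂μ := by
  set Φ : E × ℝ → E := fun p => p.2 • C w + (p.1 - ⟪w, p.1⟫ • C w) with hΦ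
  have hmap : (μ.prod (gaussianReal 0 1)).map Φ = μ := map_resample_prod_gaussianReal hC hμ hw
  have hΦm : Continuous Φ := by fun_prop
  have hfc : Continuous f := hf.continuous
  have hf'c : Continuous fun x => fderiv ℝ f x (C w) :=
    (hf.continuous_fderiv one_ne_zero).clm_apply continuous_const
  have hbound (x : E) : |fderiv ℝ f x (C w)| ≤ M' * ‖C w‖ :=
    ((fderiv ℝ f x).le_opNorm (C w)).trans (by gcongr; exact hM' x)
  have hinner (p : E × ℝ) : ⟪w, Φ p⟫ = p.2 := by
    simp only [hΦ, inner_add_right, inner_sub_right, real_inner_smul_right, hw]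
    ring
  have hid : Integrable (fun x : ℝ => x) (gaussianReal 0 1) :=
    (memLp_id_gaussianReal' 1 ENNReal.one_ne_top).integrable le_rfl
  conv_lhs => rw [← hmap]
  conv_rhs => rw [← hmap]
  rw [integral_map hΦm.aemeasurable (by fun_prop),
    integral_map hΦm.aemeasurable hf'c.aestronglyMeasurable]
  simp_rw [hinner]
  rw [integral_prod, integral_prod]
  · congr with y
    refine integral_mul_gaussianReal_eq_integral_deriv (fun x => ?_) ?_ (fun x => hM _)
      (fun x => hbound _)
    · have h1 : HasDerivAt (fun x : ℝ => Φ (y, x)) (C w) x := by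
        have h := ((hasDerivAt_id x).smul_const (C w)).add_const (y - ⟪w, y⟫ • C w)
        rwa [one_smul] at h
      exact ((hf.differentiable one_ne_zero _).hasFDerivAt).comp_hasDerivAt x h1
    · exact hf'c.comp (hΦm.comp (by fun_prop))
  · exact Integrable.of_bound (hf'c.comp hΦm).aestronglyMeasurable _
      (Filter.Eventually.of_forall fun p => hbound _)
  · exact (hid.comp_snd μ).mul_bdd (hfc.comp hΦm).aestronglyMeasurable
      (Filter.Eventually.of_forall fun p => hM _)

/-- Gaussian integration by parts in a direction of positive variance. -/
lemma integral_inner_mul_eq_integral_fderiv {C : E →L[ℝ] E}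
    (hC : ∀ x y, ⟪C x, y⟫ = ⟪x, C y⟫) {μ : Measure E} [IsProbabilityMeasure μ]
    (hμ : ∀ t, charFun μ t = Complex.exp (-(⟪t, C t⟫ : ℝ) / 2))
    {w : E} (hw : 0 < ⟪w, C w⟫) {f : E → ℝ} (hf : ContDiff ℝ 1 f)
    {M M' : ℝ} (hM : ∀ x, |f x| ≤ M) (hM' : ∀ x, ‖fderiv ℝ f x‖ ≤ M') :
    ∫ x, ⟪w, x⟫ * f x ∂μ = ∫ x, fderiv ℝ f x (C w) ∂μ := by
  set s := √⟪w, C w⟫ with hs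
  have hs0 : s ≠ 0 := (Real.sqrt_pos.2 hw).ne'
  have hss : s ^ 2 = ⟪w, C w⟫ := Real.sq_sqrt hw.le
  have hunit : ⟪s⁻¹ • w, C (s⁻¹ • w)⟫ = 1 := by
    simp only [map_smul, real_inner_smul_left, real_inner_smul_right, ← hss]
    field_simp
  have h := integral_inner_mul_eq_integral_fderiv_of_inner_eq_one hC hμ hunit hf hM hM'
  simp only [map_smul, real_inner_smul_left, smul_eq_mul, mul_assoc, integral_const_mul] at h
  exact mul_left_cancel₀ (inv_ne_zero hs0) h

end Gaussian

section Laplacian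

variable {n : ℕ} [NeZero n]

lemma ZMod.sum_mul_laplacian_eq (x y : ZMod n → ℝ) :
    ∑ i, x i * (y (i + 1) - 2 * y i + y (i - 1)) =
      ∑ i, (x (i + 1) - 2 * x i + x (i - 1)) * y i := by
  have h1 : ∑ i, x i * y (i + 1) = ∑ i, x (i - 1) * y i := by
    rw [← Equiv.sum_comp (Equiv.addRight (1 : ZMod n)) fun i => x (i - 1) * y i]
    simp
  have h2 : ∑ i, x i * y (i - 1) = ∑ i, x (i + 1) * y i := by
    rw [← Equiv.sum_comp (Equiv.addRight (1 : ZMod n)) fun i => x i * y (i - 1)]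
    simp
  have hl : ∑ i, x i * (y (i + 1) - 2 * y i + y (i - 1)) =
      ∑ i, x i * y (i + 1) - 2 * ∑ i, x i * y i + ∑ i, x i * y (i - 1) := by
    rw [Finset.mul_sum, ← Finset.sum_sub_distrib, ← Finset.sum_add_distrib]
    exact Finset.sum_congr rfl fun i _ => by ring
  have hr : ∑ i, (x (i + 1) - 2 * x i + x (i - 1)) * y i =
      ∑ i, x (i + 1) * y i - 2 * ∑ i, x i * y i + ∑ i, x (i - 1) * y i := by
    rw [Finset.mul_sum, ← Finset.sum_sub_distrib, ← Finset.sum_add_distrib]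
    exact Finset.sum_congr rfl fun i _ => by ring
  rw [hl, hr, h1, h2]
  ring

lemma ZMod.sum_laplacian_mul_self (x : ZMod n → ℝ) :
    ∑ i, (x (i + 1) - 2 * x i + x (i - 1)) * x i = -∑ i, (x (i + 1) - x i) ^ 2 := by
  have h1 : ∑ i, x (i + 1) * x i = ∑ i, x i * x (i - 1) := by
    rw [← Equiv.sum_comp (Equiv.addRight (1 : ZMod n)) fun i => x i * x (i - 1)]
    simp
  have h2 : ∑ i, x (i + 1) ^ 2 = ∑ i, x i ^ 2 :=
    Equiv.sum_comp (Equiv.addRight (1 : ZMod n)) fun i => x i ^ 2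
  have hl : ∑ i, (x (i + 1) - 2 * x i + x (i - 1)) * x i =
      ∑ i, x (i + 1) * x i - 2 * ∑ i, x i ^ 2 + ∑ i, x i * x (i - 1) := by
    rw [Finset.mul_sum, ← Finset.sum_sub_distrib, ← Finset.sum_add_distrib]
    exact Finset.sum_congr rfl fun i _ => by ring
  have hr : ∑ i, (x (i + 1) - x i) ^ 2 =
      ∑ i, x (i + 1) ^ 2 - 2 * ∑ i, x (i + 1) * x i + ∑ i, x i ^ 2 := by
    rw [Finset.mul_sum, ← Finset.sum_sub_distrib, ← Finset.sum_add_distrib]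
    exact Finset.sum_congr rfl fun i _ => by ring
  rw [hl, hr, h1, h2]
  ring

lemma ZMod.eq_zero_of_forall_succ_eq_of_sum_eq_zero {x : ZMod n → ℝ}
    (h : ∀ i, x (i + 1) = x i) (hx : ∑ i, x i = 0) : x = 0 := by
  have hconst (k : ℕ) : x k = x 0 := by
    induction k with
    | zero => simp
    | succ k ih => rw [Nat.cast_succ, h, ih]
  have hall (i : ZMod n) : x i = x 0 := by
    rw [← ZMod.natCast_zmod_val i, hconst]
  have h0 : x 0 = 0 := by
    simpa [hall, NeZero.ne n] using hx
  exact funext fun i => (hall i).trans h0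

end Laplacian


/-- Gaussian integration by parts for the measure `μ = 𝒩(0, −Δ_n⁻¹)` on the mean-zero
hyperplane: for mean-zero `v` and a bounded `C¹` function `f` with bounded derivative,
`−∫ ∂_v f dμ = ∫ (vᵀΔ_n ℓ) f(ℓ) μ(dℓ)`. Here `C` is the covariance (the inverse of
`−Δ_n` on the mean-zero hyperplane, vanishing on constants), and `μ` is characterized
by its characteristic function. -/
theorem stmt10 (n : ℕ) [NeZero n] (hn : 2 ≤ n)
    (C : EuclideanSpace ℝ (ZMod n) →L[ℝ] EuclideanSpace ℝ (ZMod n))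
    (hCsymm : ∀ x y : EuclideanSpace ℝ (ZMod n), ∑ i : ZMod n, C x i * y i = ∑ i : ZMod n, x i * C y i)
    (hCconst : ∀ c : EuclideanSpace ℝ (ZMod n), (∀ i j : ZMod n, c i = c j) → C c = 0)
    (hCinv : ∀ y : EuclideanSpace ℝ (ZMod n), (∑ i : ZMod n, y i = 0) →
      (∑ i : ZMod n, C y i = 0) ∧
      ∀ i : ZMod n, -(C y (i + 1) - 2 * C y i + C y (i - 1)) = y i)
    (μ : Measure (EuclideanSpace ℝ (ZMod n))) [IsProbabilityMeasure μ]
    (hμ : ∀ v : EuclideanSpace ℝ (ZMod n),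
      ∫ ℓ, Complex.exp (Complex.I * ((∑ i : ZMod n, v i * ℓ i : ℝ) : ℂ)) ∂μ =
        Complex.exp (-((∑ i : ZMod n, v i * C v i : ℝ) : ℂ) / 2))
    (v : EuclideanSpace ℝ (ZMod n)) (hv : ∑ i : ZMod n, v i = 0)
    (f : EuclideanSpace ℝ (ZMod n) → ℝ)
    (hf : ContDiff ℝ 1 f)
    (hfb : ∃ M : ℝ, ∀ x, |f x| ≤ M)
    (hfd : ∃ M : ℝ, ∀ x, ‖fderiv ℝ f x‖ ≤ M) :
    -∫ ℓ, fderiv ℝ f ℓ v ∂μ =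
      ∫ ℓ, (∑ i : ZMod n, v i * (ℓ (i + 1) - 2 * ℓ i + ℓ (i - 1))) * f ℓ ∂μ := by
  obtain ⟨M, hM⟩ := hfb
  obtain ⟨M', hM'⟩ := hfd
  have hinner (x y : EuclideanSpace ℝ (ZMod n)) : inner ℝ x y = ∑ i, x i * y i := by
    simp [PiLp.inner_apply, mul_comm]
  set w : EuclideanSpace ℝ (ZMod n) := WithLp.toLp 2 fun i => v (i + 1) - 2 * v i + v (i - 1)
    with hw
  have hws : ∑ i, w i = 0 := by
    simpa [hw] using (ZMod.sum_mul_laplacian_eq (fun _ : ZMod n => (1 : ℝ)) v).trans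
      (by norm_num)
  have hCw : C w = -v := by
    rw [eq_neg_iff_add_eq_zero, ← inner_self_eq_zero (𝕜 := ℝ)]
    set y := C w + v with hy
    have hys : ∑ i, y i = 0 := by
      simp [hy, Finset.sum_add_distrib, (hCinv w hws).1, hv]
    have h1 : ∑ i, C w i * y i = -∑ i, v i * y i := by
      rw [hCsymm, ← Finset.sum_neg_distrib]
      calc ∑ i, w i * C y i = ∑ i, v i * (C y (i + 1) - 2 * C y i + C y (i - 1)) :=
            (ZMod.sum_mul_laplacian_eq v (C y)).symm
        _ = ∑ i, -(v i * y i) := Finset.sum_congr rfl fun i _ => by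
            rw [← (hCinv y hys).2 i]; ring
    rw [hinner]
    calc ∑ i, y i * y i = ∑ i, C w i * y i + ∑ i, v i * y i := by
          rw [← Finset.sum_add_distrib]
          exact Finset.sum_congr rfl fun i _ => by simp [hy, add_mul]
      _ = 0 := by rw [h1]; ring
  have hvar : inner ℝ w (C w) = ∑ i, (v (i + 1) - v i) ^ 2 := by
    have h := ZMod.sum_laplacian_mul_self v
    rw [hCw, inner_neg_right, hinner, neg_eq_iff_eq_neg]
    exact h
  have hsum (ℓ : EuclideanSpace ℝ (ZMod n)) :
      ∑ i, v i * (ℓ (i + 1) - 2 * ℓ i + ℓ (i - 1)) = inner ℝ w ℓ := by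
    rw [hinner]
    exact ZMod.sum_mul_laplacian_eq v ℓ
  simp_rw [hsum]
  rcases (Finset.sum_nonneg fun i _ => sq_nonneg (v (i + 1) - v i)).eq_or_lt with h0 | hpos
  · have hv0 : v = 0 := by
      have h := (Finset.sum_eq_zero_iff_of_nonneg fun i _ => sq_nonneg (v (i + 1) - v i)).1 h0.symm
      ext i
      exact congrFun (ZMod.eq_zero_of_forall_succ_eq_of_sum_eq_zero
        (fun i => by simpa [sub_eq_zero] using h i (Finset.mem_univ i)) hv) i
    have hw0 : w = 0 := by
      ext i
      simp [hw, hv0]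
    simp [hw0, hv0]
  · rw [integral_inner_mul_eq_integral_fderiv (C := C) (fun x y => by rw [hinner, hinner, hCsymm])
      (fun t => ?_) (hvar ▸ hpos) hf hM hM', hCw]
    · simp [integral_neg]
    · rw [charFun_apply, hinner, ← hμ]
      congr with x
      rw [mul_comm Complex.I, real_inner_comm, hinner]
end

section
/- Let n ≥ 2. Let μ be the centered Gaussian measure on EuclideanSpace ℝ (ℤ/nℤ) with covariance C. Let v, w : ℤ/nℤ → ℝ with Σ_i v_i = 0 and Σ_i w_i = 0, and let g : EuclideanSpace ℝ (ℤ/nℤ) → ℝ be twice continuously differentiable with g and its first and second derivatives bounded. Then ∫ (vᵀℓ)²·(∂_w g(ℓ))² μ(dℓ) ≤ 2·⟨v, Cv⟩·∫ (∂_w g)² dμ + 4·∫ (∂²_{Cv,w} g)² dμ, where ∂²_{Cv,w}g(ℓ) denotes the second derivative of g at ℓ applied to the pair of directions (Cv, w). -/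
open MeasureTheory ProbabilityTheory

theorem integral_sq_mul_sq_gaussianReal_le {φ φ' : ℝ → ℝ}
    (hφ : ∀ x, HasDerivAt φ (φ' x) x) (hφ' : Continuous φ')
    {M M' : ℝ} (hM : ∀ x, |φ x| ≤ M) (hM' : ∀ x, |φ' x| ≤ M') :
    ∫ x, x ^ 2 * φ x ^ 2 ∂gaussianReal 0 1 ≤
      2 * ∫ x, φ x ^ 2 ∂gaussianReal 0 1 + 4 * ∫ x, φ' x ^ 2 ∂gaussianReal 0 1 := by
  have hφc : Continuous φ := continuous_iff_continuousAt.2 fun x => (hφ x).continuousAt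
  have e : ∀ f : ℝ → ℝ, ∫ x, f x ∂gaussianReal 0 1 =
      (√(2 * Real.pi))⁻¹ * ∫ x, Real.exp (-(1 / 2) * x ^ 2) * f x := by
    intro f
    rw [integral_gaussianReal_eq_integral_smul one_ne_zero, ← integral_const_mul]
    congr 1
    ext x
    simp only [gaussianPDFReal, smul_eq_mul, NNReal.coe_one, sub_zero, mul_one]
    rw [mul_assoc]
    congr 3
    ring
  have i0 : Integrable fun x : ℝ => Real.exp (-(1 / 2) * x ^ 2) :=
    integrable_exp_neg_mul_sq (by norm_num)
  have i1 : Integrable fun x : ℝ => x * Real.exp (-(1 / 2) * x ^ 2) :=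
    integrable_mul_exp_neg_mul_sq (by norm_num)
  have i2 : Integrable fun x : ℝ => x ^ 2 * Real.exp (-(1 / 2) * x ^ 2) := by
    simpa using integrable_rpow_mul_exp_neg_mul_sq (b := 1 / 2) (by norm_num) (s := 2) (by norm_num)
  have bdd : ∀ {f h : ℝ → ℝ} {K : ℝ}, Integrable f → Continuous h → (∀ x, |h x| ≤ K) →
      Integrable fun x => f x * h x := fun hf hh hK =>
    hf.mul_bdd hh.aestronglyMeasurable (Filter.Eventually.of_forall hK)
  have b2 : ∀ x, |φ x ^ 2| ≤ M ^ 2 := fun x => by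
    rw [abs_pow]; exact pow_le_pow_left₀ (abs_nonneg _) (hM x) 2
  have b2' : ∀ x, |φ' x ^ 2| ≤ M' ^ 2 := fun x => by
    rw [abs_pow]; exact pow_le_pow_left₀ (abs_nonneg _) (hM' x) 2
  have b1 : ∀ x, |φ x * φ' x| ≤ M * M' := fun x => by
    rw [abs_mul]
    exact mul_le_mul (hM x) (hM' x) (abs_nonneg _) ((abs_nonneg _).trans (hM x))
  have j0 : Integrable fun x => Real.exp (-(1 / 2) * x ^ 2) * φ x ^ 2 := bdd i0 (hφc.pow 2) b2
  have j0' : Integrable fun x => Real.exp (-(1 / 2) * x ^ 2) * φ' x ^ 2 := bdd i0 (hφ'.pow 2) b2'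
  have j1 : Integrable fun x => x * Real.exp (-(1 / 2) * x ^ 2) * (φ x * φ' x) :=
    bdd i1 (hφc.mul hφ') b1
  have j1' : Integrable fun x => x * Real.exp (-(1 / 2) * x ^ 2) * φ x ^ 2 := bdd i1 (hφc.pow 2) b2
  have j2 : Integrable fun x => x ^ 2 * Real.exp (-(1 / 2) * x ^ 2) * φ x ^ 2 :=
    bdd i2 (hφc.pow 2) b2
  have jA : Integrable fun x => x ^ 2 * Real.exp (-(1 / 2) * x ^ 2) * φ x ^ 2
      - Real.exp (-(1 / 2) * x ^ 2) * φ x ^ 2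
      - 2 * (x * Real.exp (-(1 / 2) * x ^ 2) * (φ x * φ' x)) :=
    (j2.sub j0).sub (j1.const_mul 2)
  have jB : Integrable fun x => 2 * (Real.exp (-(1 / 2) * x ^ 2) * φ x ^ 2)
      + 4 * (Real.exp (-(1 / 2) * x ^ 2) * φ' x ^ 2) :=
    (j0.const_mul 2).add (j0'.const_mul 4)
  have jC : Integrable fun x => 2 * (Real.exp (-(1 / 2) * x ^ 2) * φ x ^ 2)
      + 4 * (Real.exp (-(1 / 2) * x ^ 2) * φ' x ^ 2)
      - x ^ 2 * Real.exp (-(1 / 2) * x ^ 2) * φ x ^ 2 := jB.sub j2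
  have hd : ∀ x, HasDerivAt (fun x => -(x * Real.exp (-(1 / 2) * x ^ 2) * φ x ^ 2))
      (x ^ 2 * Real.exp (-(1 / 2) * x ^ 2) * φ x ^ 2 - Real.exp (-(1 / 2) * x ^ 2) * φ x ^ 2
        - 2 * (x * Real.exp (-(1 / 2) * x ^ 2) * (φ x * φ' x))) x := by
    intro x
    have h1 : HasDerivAt (fun x : ℝ => -(1 / 2) * x ^ 2) (-(1 / 2) * (2 * x)) x := by
      simpa using (hasDerivAt_pow 2 x).const_mul (-(1 / 2) : ℝ)
    refine (((hasDerivAt_id x).mul h1.exp).mul ((hφ x).pow 2)).neg.congr_deriv ?_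
    simp
    ring
  have hz := integral_eq_zero_of_hasDerivAt_of_integrable hd jA j1'.neg
  have key : 0 ≤ ∫ x, (2 * (Real.exp (-(1 / 2) * x ^ 2) * φ x ^ 2)
      + 4 * (Real.exp (-(1 / 2) * x ^ 2) * φ' x ^ 2)
      - x ^ 2 * Real.exp (-(1 / 2) * x ^ 2) * φ x ^ 2
      + 2 * (x ^ 2 * Real.exp (-(1 / 2) * x ^ 2) * φ x ^ 2
        - Real.exp (-(1 / 2) * x ^ 2) * φ x ^ 2
        - 2 * (x * Real.exp (-(1 / 2) * x ^ 2) * (φ x * φ' x)))) := by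
    refine integral_nonneg fun x => ?_
    have : 0 ≤ Real.exp (-(1 / 2) * x ^ 2) * (x * φ x - 2 * φ' x) ^ 2 := by positivity
    simp only [Pi.zero_apply]
    linarith
  rw [integral_add jC (jA.const_mul 2),
    integral_const_mul 2 (fun x => x ^ 2 * Real.exp (-(1 / 2) * x ^ 2) * φ x ^ 2
        - Real.exp (-(1 / 2) * x ^ 2) * φ x ^ 2
        - 2 * (x * Real.exp (-(1 / 2) * x ^ 2) * (φ x * φ' x))), hz, integral_sub jB j2,
    integral_add (j0.const_mul 2) (j0'.const_mul 4), integral_const_mul, integral_const_mul] at key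
  rw [e, e, e]
  have e2 : ∫ x, Real.exp (-(1 / 2) * x ^ 2) * (x ^ 2 * φ x ^ 2) =
      ∫ x, x ^ 2 * Real.exp (-(1 / 2) * x ^ 2) * φ x ^ 2 := by
    congr 1; ext x; ring
  rw [e2]
  have hc : 0 ≤ (√(2 * Real.pi))⁻¹ := by positivity
  nlinarith [mul_nonneg hc key]

section

variable {E : Type*} [NormedAddCommGroup E] [InnerProductSpace ℝ E] [MeasurableSpace E]
  {μ : Measure E} [IsProbabilityMeasure μ] {C : E →L[ℝ] E}

theorem inner_self_nonneg_of_charFun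
    (hμ : ∀ t, charFun μ t = Complex.exp (-(inner ℝ t (C t) : ℝ) / 2)) (v : E) :
    0 ≤ inner ℝ v (C v) := by
  have h := norm_charFun_le_one (μ := μ) v
  rw [hμ, Complex.norm_exp, Real.exp_le_one_iff] at h
  have : (-((inner ℝ v (C v) : ℝ) : ℂ) / 2).re = -(inner ℝ v (C v)) / 2 := by
    norm_cast
  linarith

variable [BorelSpace E]

theorem inner_ae_eq_zero_of_charFun
    (hμ : ∀ t, charFun μ t = Complex.exp (-(inner ℝ t (C t) : ℝ) / 2))
    {v : E} (hv : inner ℝ v (C v) = 0) : ∀ᵐ x ∂μ, inner ℝ v x = 0 := by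
  have hm : AEMeasurable (fun x => inner ℝ v x) μ :=
    (by fun_prop : Continuous fun x => inner ℝ v x).aemeasurable
  have := Measure.isProbabilityMeasure_map hm
  have h : μ.map (fun x => inner ℝ v x) = Measure.dirac 0 := by
    refine Measure.ext_of_charFun (funext fun t => ?_)
    rw [charFun_apply_real, integral_map hm (by fun_prop), charFun_dirac]
    have h1 := hμ (t • v)
    rw [charFun_apply, map_smul, real_inner_smul_left, real_inner_smul_right, hv] at h1
    simpa [real_inner_smul_right, real_inner_comm] using h1
  have h0 : ∀ᵐ y ∂μ.map (fun x => inner ℝ v x), y = 0 := by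
    rw [h]; simp [ae_dirac_eq]
  exact ae_of_ae_map hm h0

variable [CompleteSpace E] [SecondCountableTopology E]

/-- The component of a centered Gaussian vector along `C v` can be resampled independently. -/
theorem map_resample_eq_of_charFun
    (hC : ∀ x y, inner ℝ (C x) y = inner ℝ x (C y))
    (hμ : ∀ t, charFun μ t = Complex.exp (-(inner ℝ t (C t) : ℝ) / 2))
    {v : E} (hv : 0 < inner ℝ v (C v)) :
    ((gaussianReal 0 1).prod μ).map (fun p => (p.1 / √(inner ℝ v (C v))) • C v +
      (p.2 - (inner ℝ v p.2 / inner ℝ v (C v)) • C v)) = μ := by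
  set s := inner ℝ v (C v) with hs
  have hT : Continuous fun p : ℝ × E => (p.1 / √s) • C v + (p.2 - (inner ℝ v p.2 / s) • C v) := by
    fun_prop
  have := Measure.isProbabilityMeasure_map (μ := (gaussianReal 0 1).prod μ) hT.aemeasurable
  refine Measure.ext_of_charFun (funext fun t => ?_)
  set r := inner ℝ (C v) t with hr
  rw [charFun_apply, integral_map hT.aemeasurable (by fun_prop)]
  have : ∀ p : ℝ × E,
      Complex.exp (inner ℝ ((p.1 / √s) • C v + (p.2 - (inner ℝ v p.2 / s) • C v)) t * Complex.I) =
      Complex.exp ((r / √s : ℝ) * p.1 * Complex.I) *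
        Complex.exp (inner ℝ p.2 (t - (r / s) • v) * Complex.I) := by
    intro p
    rw [← Complex.exp_add, inner_add_left, inner_sub_left, inner_sub_right, real_inner_smul_left,
      real_inner_smul_left, real_inner_smul_right, ← hr, real_inner_comm v p.2]
    congr 1
    push_cast
    ring
  simp_rw [this]
  rw [integral_prod_mul (fun x : ℝ => Complex.exp ((r / √s : ℝ) * x * Complex.I))
    (fun x : E => Complex.exp (inner ℝ x (t - (r / s) • v) * Complex.I)),
    ← charFun_apply_real, ← charFun_apply, charFun_gaussianReal, hμ, hμ, ← Complex.exp_add]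
  have h1 : inner ℝ v (C t) = r := by rw [← hC]
  have h2 : inner ℝ t (C v) = r := real_inner_comm _ _
  have h3 : (r / √s) ^ 2 = r ^ 2 / s := by rw [div_pow, Real.sq_sqrt hv.le]
  have h4 : inner ℝ (t - (r / s) • v) (C (t - (r / s) • v)) = inner ℝ t (C t) - r ^ 2 / s := by
    rw [map_sub, map_smul, inner_sub_left, inner_sub_right, inner_sub_right, real_inner_smul_left,
      real_inner_smul_left, real_inner_smul_right, real_inner_smul_right, h1, h2, ← hs]
    field_simp
    ring
  rw [h4, ← Complex.ofReal_pow, h3]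
  congr 1
  push_cast
  ring

/-- A weighted Poincaré-type bound for a centered Gaussian measure with covariance `C`. -/
theorem integral_inner_sq_mul_sq_le_of_charFun
    (hC : ∀ x y, inner ℝ (C x) y = inner ℝ x (C y))
    (hμ : ∀ t, charFun μ t = Complex.exp (-(inner ℝ t (C t) : ℝ) / 2))
    (v : E) {f : E → ℝ} (hf : ContDiff ℝ 1 f) {M M' : ℝ}
    (hM : ∀ x, |f x| ≤ M) (hM' : ∀ x, |fderiv ℝ f x (C v)| ≤ M') :
    ∫ x, inner ℝ v x ^ 2 * f x ^ 2 ∂μ ≤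
      2 * inner ℝ v (C v) * ∫ x, f x ^ 2 ∂μ + 4 * ∫ x, fderiv ℝ f x (C v) ^ 2 ∂μ := by
  have hs0 := inner_self_nonneg_of_charFun hμ v
  rcases hs0.eq_or_lt with h0 | hpos
  · have : ∫ x, inner ℝ v x ^ 2 * f x ^ 2 ∂μ = 0 := by
      refine integral_eq_zero_of_ae ?_
      filter_upwards [inner_ae_eq_zero_of_charFun hμ h0.symm] with x hx
      simp [hx]
    rw [this]
    positivity
  have hmap := map_resample_eq_of_charFun hC hμ hpos
  set s := inner ℝ v (C v) with hs
  have hrs : 0 < √s := Real.sqrt_pos.2 hpos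
  have hT : Continuous fun p : ℝ × E => (p.1 / √s) • C v + (p.2 - (inner ℝ v p.2 / s) • C v) := by
    fun_prop
  set T := fun p : ℝ × E => (p.1 / √s) • C v + (p.2 - (inner ℝ v p.2 / s) • C v) with hTdef
  have hfc : Continuous f := hf.continuous
  have hf'c : Continuous fun x => fderiv ℝ f x (C v) :=
    (hf.continuous_fderiv one_ne_zero).clm_apply continuous_const
  have hinner : ∀ p, inner ℝ v (T p) = √s * p.1 := by
    intro p
    simp only [hTdef, inner_add_right, inner_sub_right, real_inner_smul_right, ← hs]
    rw [div_mul_cancel₀ _ hpos.ne', sub_self, add_zero, div_mul_eq_mul_div, mul_div_assoc,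
      Real.div_sqrt, mul_comm]
  have hI : ∀ h : E → ℝ, Continuous h →
      ∫ x, h x ∂μ = ∫ p, h (T p) ∂(gaussianReal 0 1).prod μ := by
    intro h hh
    conv_lhs => rw [← hmap]
    exact integral_map hT.aemeasurable hh.aestronglyMeasurable
  have b2 : ∀ x, ‖f x ^ 2‖ ≤ M ^ 2 := fun x => by
    rw [norm_pow]; exact pow_le_pow_left₀ (abs_nonneg _) (hM x) 2
  have b2' : ∀ x, ‖fderiv ℝ f x (C v) ^ 2‖ ≤ M' ^ 2 := fun x => by
    rw [norm_pow]; exact pow_le_pow_left₀ (abs_nonneg _) (hM' x) 2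
  have I0 : Integrable (fun p => f (T p) ^ 2) ((gaussianReal 0 1).prod μ) :=
    Integrable.of_bound ((hfc.comp hT).pow 2).aestronglyMeasurable (M ^ 2) (.of_forall fun p => b2 _)
  have I1 : Integrable (fun p => fderiv ℝ f (T p) (C v) ^ 2) ((gaussianReal 0 1).prod μ) :=
    Integrable.of_bound ((hf'c.comp hT).pow 2).aestronglyMeasurable (M' ^ 2)
      (.of_forall fun p => b2' _)
  have I2 : Integrable (fun p => (√s * p.1) ^ 2 * f (T p) ^ 2) ((gaussianReal 0 1).prod μ) := by
    have hx : Integrable (fun x : ℝ => (√s * x) ^ 2) (gaussianReal 0 1) := by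
      simp_rw [mul_pow]
      exact ((memLp_id_gaussianReal 2).integrable_sq).const_mul _
    exact (hx.comp_fst μ).mul_bdd ((hfc.comp hT).pow 2).aestronglyMeasurable
      (.of_forall fun p => b2 _)
  rw [hI _ (by fun_prop), hI _ (by fun_prop), hI _ (by fun_prop)]
  simp_rw [hinner]
  rw [integral_prod_symm _ I0, integral_prod_symm _ I1, integral_prod_symm _ I2,
    ← integral_const_mul, ← integral_const_mul,
    ← integral_add (I0.integral_prod_right.const_mul _) (I1.integral_prod_right.const_mul _)]
  refine integral_mono I2.integral_prod_right
    ((I0.integral_prod_right.const_mul _).add (I1.integral_prod_right.const_mul _)) fun y => ?_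
  have hd : ∀ x, HasDerivAt (fun x => f (T (x, y))) (fderiv ℝ f (T (x, y)) (C v) / √s) x := by
    intro x
    have h1 : HasDerivAt (fun x => T (x, y)) ((1 / √s) • C v) x :=
      (((hasDerivAt_id' x).div_const (√s)).smul_const (C v)).add_const
        (y - (inner ℝ v y / s) • C v)
    have h2 := ((hf.differentiable one_ne_zero) (T (x, y))).hasFDerivAt.comp_hasDerivAt x h1
    rwa [map_smul, smul_eq_mul, one_div, inv_mul_eq_div] at h2
  have hTy : Continuous fun x : ℝ => T (x, y) := hT.comp (by fun_prop)
  have key := integral_sq_mul_sq_gaussianReal_le hd ((hf'c.comp hTy).div_const _)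
    (fun x => hM _) (M' := M' / √s) (fun x => by
      rw [abs_div, abs_of_pos hrs]
      exact div_le_div_of_nonneg_right (hM' _) hrs.le)
  simp only [div_pow, Real.sq_sqrt hpos.le, integral_div] at key
  simp only [mul_pow, Real.sq_sqrt hpos.le, mul_assoc, integral_const_mul]
  calc _ ≤ s * _ := mul_le_mul_of_nonneg_left key hpos.le
    _ = _ := by field_simp

end



/-- Lemma `lem:ibpboundmu`: for the Gaussian measure `μ = 𝒩(0, −Δ_n⁻¹)` on the mean-zero
hyperplane, mean-zero vectors `v, w` and a bounded `C²` function `g` with bounded first and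
second derivatives,
`∫ (vᵀℓ)² (∂_w g)² dμ ≤ 2⟨v, Cv⟩ ∫ (∂_w g)² dμ + 4 ∫ (∂²_{Cv,w} g)² dμ`. -/
theorem stmt11 (n : ℕ) [NeZero n] (hn : 2 ≤ n)
    (C : EuclideanSpace ℝ (ZMod n) →L[ℝ] EuclideanSpace ℝ (ZMod n))
    (hCsymm : ∀ x y : EuclideanSpace ℝ (ZMod n), ∑ i : ZMod n, C x i * y i = ∑ i : ZMod n, x i * C y i)
    (hCconst : ∀ c : EuclideanSpace ℝ (ZMod n), (∀ i j : ZMod n, c i = c j) → C c = 0)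
    (hCinv : ∀ y : EuclideanSpace ℝ (ZMod n), (∑ i : ZMod n, y i = 0) →
      (∑ i : ZMod n, C y i = 0) ∧
      ∀ i : ZMod n, -(C y (i + 1) - 2 * C y i + C y (i - 1)) = y i)
    (μ : Measure (EuclideanSpace ℝ (ZMod n))) [IsProbabilityMeasure μ]
    (hμ : ∀ v : EuclideanSpace ℝ (ZMod n),
      ∫ ℓ, Complex.exp (Complex.I * ((∑ i : ZMod n, v i * ℓ i : ℝ) : ℂ)) ∂μ =
        Complex.exp (-((∑ i : ZMod n, v i * C v i : ℝ) : ℂ) / 2))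
    (v w : EuclideanSpace ℝ (ZMod n))
    (hv : ∑ i : ZMod n, v i = 0) (hw : ∑ i : ZMod n, w i = 0)
    (g : EuclideanSpace ℝ (ZMod n) → ℝ)
    (hg : ContDiff ℝ 2 g)
    (hgb : ∃ M : ℝ, ∀ x, |g x| ≤ M)
    (hg1 : ∃ M : ℝ, ∀ x, ‖fderiv ℝ g x‖ ≤ M)
    (hg2 : ∃ M : ℝ, ∀ x, ‖fderiv ℝ (fderiv ℝ g) x‖ ≤ M) :
    ∫ ℓ, (∑ i : ZMod n, v i * ℓ i) ^ 2 * (fderiv ℝ g ℓ w) ^ 2 ∂μ ≤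
      2 * (∑ i : ZMod n, v i * C v i) * ∫ ℓ, (fderiv ℝ g ℓ w) ^ 2 ∂μ +
        4 * ∫ ℓ, (fderiv ℝ (fun x => fderiv ℝ g x w) ℓ (C v)) ^ 2 ∂μ := by
  have hin : ∀ x y : EuclideanSpace ℝ (ZMod n), inner ℝ x y = ∑ i, x i * y i := fun x y => by
    simp [PiLp.inner_apply, mul_comm]
  obtain ⟨M₁, hM₁⟩ := hg1
  obtain ⟨M₂, hM₂⟩ := hg2
  have hg' : ContDiff ℝ 1 (fderiv ℝ g) := hg.fderiv_right (by norm_num)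
  have hder : ∀ x u, fderiv ℝ (fun x => fderiv ℝ g x w) x u = fderiv ℝ (fderiv ℝ g) x u w := by
    intro x u
    rw [fderiv_clm_apply (hg'.differentiable one_ne_zero x) (differentiableAt_const w)]
    simp
  have main := integral_inner_sq_mul_sq_le_of_charFun (μ := μ) (C := C)
    (fun x y => by simpa only [hin] using hCsymm x y)
    (fun t => by
      rw [charFun_apply, hin, ← hμ t]
      congr 1
      ext x
      rw [hin, mul_comm]
      simp_rw [mul_comm])
    v (hg'.clm_apply contDiff_const : ContDiff ℝ 1 fun x => fderiv ℝ g x w)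
    (M := M₁ * ‖w‖) (M' := M₂ * ‖C v‖ * ‖w‖)
    (fun x => (fderiv ℝ g x).le_of_opNorm_le (hM₁ x) w)
    (fun x => by
      rw [hder]
      exact (ContinuousLinearMap.le_of_opNorm_le _
        (ContinuousLinearMap.le_of_opNorm_le _ (hM₂ x) (C v)) w))
  simpa only [hin] using main
end
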